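/- For every real number y, lim_{N→∞} √(2N/π) · ∫_{2y/√N}^{∞} dt/(1 + t²)^{N/2+1} = erfc(√2·y), where the limit is taken over positive integers N. -/

import Mathlib

open MeasureTheory Real

/-- The complementary error function `erfc s = (2/√π) ∫_s^∞ e^{-t²} dt`. -/
noncomputable def erfc (s : ℝ) : ℝ := (2 / Real.sqrt π) * ∫ t in Set.Ioi s, Real.exp (-t ^ 2)

lemma tendsto_one_add_two_mul_sq_div_rpow (s : ℝ) :
    Filter.Tendsto (fun N : ℕ => (1 + 2 * s ^ 2 / N) ^ (-((N : ℝ) / 2 + 1)))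
      Filter.atTop (nhds (exp (-s ^ 2))) := by
  have hpow : Filter.Tendsto (fun N : ℕ => ((1 + 2 * s ^ 2 / N) ^ N) ^ (-(1 / 2) : ℝ))
      Filter.atTop (nhds (exp (2 * s ^ 2) ^ (-(1 / 2) : ℝ))) :=
    (tendsto_one_add_div_pow_exp (2 * s ^ 2)).rpow_const (Or.inl (exp_pos _).ne')
  have hbase : Filter.Tendsto (fun N : ℕ => (1 + 2 * s ^ 2 / N)⁻¹) Filter.atTop (nhds 1) := by
    have hzero : Filter.Tendsto (fun N : ℕ => 2 * s ^ 2 / (N : ℝ)) Filter.atTop (nhds 0) :=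
      tendsto_const_div_atTop_nhds_zero_nat _
    have hsum : Filter.Tendsto (fun N : ℕ => 1 + 2 * s ^ 2 / (N : ℝ)) Filter.atTop (nhds 1) := by
      simpa only [add_zero] using hzero.const_add 1
    simpa only [inv_one] using hsum.inv₀ one_ne_zero
  have hlim : exp (2 * s ^ 2) ^ (-(1 / 2) : ℝ) * 1 = exp (-s ^ 2) := by
    rw [← exp_mul, mul_one]
    ring_nf
  rw [← hlim]
  refine (hpow.mul hbase).congr fun N => ?_
  have hpos : 0 < 1 + 2 * s ^ 2 / (N : ℝ) := by positivity
  rw [← rpow_natCast, ← rpow_mul hpos.le, ← rpow_neg_one, ← rpow_add hpos]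
  ring_nf

lemma one_add_two_mul_sq_div_rpow_le {N : ℕ} (hN : 0 < N) (s : ℝ) :
    (1 + 2 * s ^ 2 / N) ^ (-((N : ℝ) / 2 + 1)) ≤ (1 + s ^ 2)⁻¹ := by
  have hN' : (0 : ℝ) < N := by exact_mod_cast hN
  have hx : 0 ≤ 2 * s ^ 2 / (N : ℝ) := by positivity
  rw [rpow_neg (by positivity)]
  gcongr
  have hmul : (N : ℝ) / 2 * (2 * s ^ 2 / N) = s ^ 2 := by field_simp
  have hbernoulli := one_add_mul_self_le_rpow_one_add (s := 2 * s ^ 2 / (N : ℝ))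
    (by linarith) (p := (N : ℝ) / 2 + 1) (by linarith)
  linarith

lemma sqrt_mul_integral_Ioi_rpow_eq {N : ℕ} (hN : 0 < N) (y : ℝ) :
    sqrt (2 * N / π) * ∫ t in Set.Ioi (2 * y / sqrt N), (1 + t ^ 2) ^ (-((N : ℝ) / 2 + 1)) =
      2 / sqrt π *
        ∫ s in Set.Ioi (sqrt 2 * y), (1 + 2 * s ^ 2 / N) ^ (-((N : ℝ) / 2 + 1)) := by
  have hN' : (0 : ℝ) < N := by exact_mod_cast hN
  have hb : 0 < sqrt 2 / sqrt N := by positivity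
  have hscale := integral_comp_mul_left_Ioi'
    (fun t : ℝ => (1 + t ^ 2) ^ (-((N : ℝ) / 2 + 1))) (sqrt 2 * y) hb
  have hlower : sqrt 2 / sqrt N * (sqrt 2 * y) = 2 * y / sqrt N := by
    rw [div_mul_eq_mul_div, ← mul_assoc, mul_self_sqrt zero_le_two]
  simp only [hlower, mul_pow, div_pow, sq_sqrt hN'.le, sq_sqrt zero_le_two, smul_eq_mul,
    div_mul_eq_mul_div (2 : ℝ)] at hscale
  rw [← hscale, ← mul_assoc]
  congr 1
  rw [sqrt_div (by positivity), sqrt_mul zero_le_two]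
  have h2 : sqrt 2 * sqrt 2 = 2 := mul_self_sqrt zero_le_two
  field_simp
  linarith

/-- Scaling limit of the one-body weight of the real spherical ensemble:
`√(2N/π) ∫_{2y/√N}^∞ dt/(1+t²)^{N/2+1} → erfc(√2 y)` as `N → ∞`. -/
theorem stmt_13 (y : ℝ) :
    Filter.Tendsto (fun N : ℕ =>
        Real.sqrt (2 * N / π) *
          ∫ t in Set.Ioi (2 * y / Real.sqrt N), (1 + t ^ 2) ^ (-((N : ℝ) / 2 + 1)))
      Filter.atTop (nhds (erfc (Real.sqrt 2 * y))) := by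
  have hlim : Filter.Tendsto (fun N : ℕ =>
      ∫ s in Set.Ioi (sqrt 2 * y), (1 + 2 * s ^ 2 / N) ^ (-((N : ℝ) / 2 + 1)))
      Filter.atTop (nhds (∫ s in Set.Ioi (sqrt 2 * y), exp (-s ^ 2))) := by
    refine tendsto_integral_filter_of_dominated_convergence (fun s => (1 + s ^ 2)⁻¹)
      (.of_forall fun N => ?_) ?_ integrable_inv_one_add_sq.integrableOn
      (.of_forall tendsto_one_add_two_mul_sq_div_rpow)
    · exact Measurable.aestronglyMeasurable (by fun_prop)
    · filter_upwards [Filter.eventually_gt_atTop 0] with N hN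
      refine .of_forall fun s => ?_
      rw [norm_of_nonneg (by positivity)]
      exact one_add_two_mul_sq_div_rpow_le hN s
  refine (hlim.const_mul (2 / sqrt π)).congr' ?_
  filter_upwards [Filter.eventually_gt_atTop 0] with N hN
  exact (sqrt_mul_integral_Ioi_rpow_eq hN y).symm
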